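/- Let L be a J-trivial regular language over a two-letter alphabet with sc(L) = n, where n ≥ 4. Then sc(L^R) ≤ 2^{n-3} + min(max(2n-3, (n-2)²), 2^{n-3}) + (n - 1). -/

import Mathlib

/-- A DFA is *partially ordered* if its reachability relation
`p ≼ q ↔ ∃ w, M.evalFrom p w = q` is antisymmetric (hence a partial order). -/
def DFA.PartiallyOrderedDFA {α σ : Type} (M : DFA α σ) : Prop :=
  ∀ p q : σ, (∃ w : List α, M.evalFrom p w = q) → (∃ w : List α, M.evalFrom q w = p) → p = q

/-- A DFA is *minimal* if every state is reachable from the initial state and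
all pairs of distinct states are distinguishable. -/
def DFA.MinimalDFA {α σ : Type} (M : DFA α σ) : Prop :=
  (∀ q : σ, ∃ w : List α, M.evalFrom M.start w = q) ∧
  (∀ p q : σ, p ≠ q →
    ∃ w : List α, ¬ (M.evalFrom p w ∈ M.accept ↔ M.evalFrom q w ∈ M.accept))

/-- The *state complexity* of a language: the least number of states of a
(complete, deterministic) finite automaton accepting it. -/
noncomputable def stateComplexity {α : Type} (L : Language α) : ℕ :=
  sInf {n : ℕ | ∃ M : DFA α (Fin n), M.accepts = L}

/-- A regular language is *R-trivial* iff its minimal DFA is partially ordered. -/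
def IsRTrivial {α : Type} (L : Language α) : Prop :=
  ∃ (n : ℕ) (M : DFA α (Fin n)), M.MinimalDFA ∧ M.accepts = L ∧ M.PartiallyOrderedDFA

/-- A regular language is *J-trivial* iff the minimal DFAs of both the language
and its reverse are partially ordered. -/
def IsJTrivial {α : Type} (L : Language α) : Prop :=
  IsRTrivial L ∧ IsRTrivial L.reverse

/-- A *dead state*: a non-accepting state with a self-loop under every letter. -/
def DFA.DeadState {α σ : Type} (M : DFA α σ) (d : σ) : Prop :=
  d ∉ M.accept ∧ ∀ a : α, M.step d a = d

namespace DFA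

variable {α σ : Type} {M : DFA α σ}

/-- The set of states from which `M` accepts the word `w`. -/
def acceptSet (M : DFA α σ) (w : List α) : Set σ := {q | M.evalFrom q w ∈ M.accept}

lemma mem_acceptSet {q : σ} {w : List α} : q ∈ M.acceptSet w ↔ M.evalFrom q w ∈ M.accept := Iff.rfl

lemma mem_acceptSet_append {q : σ} {u v : List α} :
    q ∈ M.acceptSet (u ++ v) ↔ M.evalFrom q u ∈ M.acceptSet v := by
  simp [mem_acceptSet, evalFrom_of_append]

lemma mem_acceptSet_cons {q : σ} {a : α} {v : List α} :
    q ∈ M.acceptSet (a :: v) ↔ M.step q a ∈ M.acceptSet v := Iff.rfl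

lemma evalFrom_eq_self {q : σ} (h : ∀ x, M.step q x = q) (w : List α) : M.evalFrom q w = q := by
  induction w with
  | nil => rfl
  | cons x w ih => rw [evalFrom_cons, h, ih]

lemma evalFrom_replicate (q : σ) (a : α) (i : ℕ) :
    M.evalFrom q (List.replicate i a) = (fun p => M.step p a)^[i] q := by
  induction i generalizing q with
  | zero => rfl
  | succ i ih => rw [List.replicate_succ, evalFrom_cons, ih, Function.iterate_succ_apply]

/-- The states that the letter `a` does not fix. -/
def moved (M : DFA α σ) (a : α) : Set σ := {q | M.step q a ≠ q}

lemma PartiallyOrderedDFA.step_eq_of_iterate_eq (hpo : M.PartiallyOrderedDFA) {a : α} {q : σ}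
    {m : ℕ} (h : (fun p => M.step p a)^[m + 1] q = q) : M.step q a = q :=
  (hpo q (M.step q a) ⟨[a], rfl⟩
    ⟨List.replicate m a, by rw [evalFrom_replicate]; exact h⟩).symm

lemma PartiallyOrderedDFA.step_iterate [Finite σ] (hpo : M.PartiallyOrderedDFA) {a : α} {k : ℕ}
    (hk : (M.moved a).ncard ≤ k) (q : σ) :
    M.step ((fun p => M.step p a)^[k] q) a = (fun p => M.step p a)^[k] q := by
  classical
  by_contra hne
  set f : σ → σ := fun p => M.step p a with hf
  have hmoved : ∀ i ≤ k, f (f^[i] q) ≠ f^[i] q := by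
    intro i hi hfix
    apply hne
    obtain ⟨j, rfl⟩ := Nat.exists_eq_add_of_le' hi
    rw [Function.iterate_add_apply, Function.iterate_fixed hfix]
    exact hfix
  have hlt : ∀ i j, i < j → j ≤ k → f^[i] q ≠ f^[j] q := by
    intro i j hij hj heq
    obtain ⟨m, rfl⟩ := Nat.exists_eq_add_of_lt hij
    apply hmoved i (by omega)
    apply hpo.step_eq_of_iterate_eq (m := m)
    rw [← hf, ← Function.iterate_add_apply, show m + 1 + i = i + m + 1 by ring]
    exact heq.symm
  have hinj : Set.InjOn (fun i => f^[i] q) (Finset.range (k + 1) : Set ℕ) := by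
    intro i hi j hj heq
    simp only [Finset.coe_range, Set.mem_Iio] at hi hj
    rcases lt_trichotomy i j with h | h | h
    · exact absurd heq (hlt i j h (by omega))
    · exact h
    · exact absurd heq.symm (hlt j i h (by omega))
  have hcard := Set.ncard_le_ncard (s := (fun i => f^[i] q) '' (Finset.range (k + 1) : Set ℕ))
    (t := M.moved a) (by
      rintro _ ⟨i, hi, rfl⟩
      simp only [Finset.coe_range, Set.mem_Iio] at hi
      exact hmoved i (by omega)) (Set.toFinite _)
  rw [hinj.ncard_image, Set.ncard_coe_finset, Finset.card_range] at hcard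
  omega

lemma PartiallyOrderedDFA.iterate_min [Finite σ] (hpo : M.PartiallyOrderedDFA) {a : α} {k : ℕ}
    (hk : (M.moved a).ncard ≤ k) (i : ℕ) (q : σ) :
    (fun p => M.step p a)^[min i k] q = (fun p => M.step p a)^[i] q := by
  rcases le_total i k with h | h
  · rw [min_eq_left h]
  · obtain ⟨j, rfl⟩ := Nat.exists_eq_add_of_le' h
    rw [min_eq_right h, Function.iterate_add_apply,
      Function.iterate_fixed (f := fun p => M.step p a) (hpo.step_iterate hk q)]

lemma PartiallyOrderedDFA.acceptSet_replicate_min [Finite σ] (hpo : M.PartiallyOrderedDFA) {a : α}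
    {k : ℕ} (hk : (M.moved a).ncard ≤ k) (i : ℕ) (w : List α) :
    M.acceptSet (List.replicate (min i k) a ++ w) = M.acceptSet (List.replicate i a ++ w) := by
  ext q
  simp only [mem_acceptSet_append, evalFrom_replicate, hpo.iterate_min hk]

lemma PartiallyOrderedDFA.acceptSet_replicate_min' [Finite σ] (hpo : M.PartiallyOrderedDFA) {a : α}
    {k : ℕ} (hk : (M.moved a).ncard ≤ k) (i : ℕ) :
    M.acceptSet (List.replicate (min i k) a) = M.acceptSet (List.replicate i a) := by
  simpa using hpo.acceptSet_replicate_min hk i []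

lemma acceptSet_append_congr {v v' : List α} (h : M.acceptSet v = M.acceptSet v') (u : List α) :
    M.acceptSet (u ++ v) = M.acceptSet (u ++ v') := by
  ext q
  rw [mem_acceptSet_append, mem_acceptSet_append, h]

lemma acceptSet_cons_congr {v v' : List α} (h : M.acceptSet v = M.acceptSet v') (a : α) :
    M.acceptSet (a :: v) = M.acceptSet (a :: v') :=
  acceptSet_append_congr h [a]

lemma PartiallyOrderedDFA.exists_maximal [Finite σ] (hpo : M.PartiallyOrderedDFA) {T : Set σ}
    (hT : T.Nonempty) : ∃ m ∈ T, ∀ w, M.evalFrom m w ∈ T → M.evalFrom m w = m := by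
  let _ : PartialOrder σ :=
    { le := fun p q => ∃ w, M.evalFrom p w = q
      le_refl := fun p => ⟨[], rfl⟩
      le_trans := by
        rintro p q r ⟨u, rfl⟩ ⟨v, rfl⟩
        exact ⟨u ++ v, M.evalFrom_of_append _ _ _⟩
      le_antisymm := hpo }
  obtain ⟨m, hm⟩ := T.toFinite.exists_maximal hT
  exact ⟨m, hm.1, fun w hw => (hm.eq_of_le hw ⟨w, rfl⟩).symm⟩

/-- A word accepted from a state with a loop labelled `a` either stays in the loop or leaves it. -/
lemma eq_replicate_or_of_mem_acceptSet {a b : α} (hab : ∀ x, x = a ∨ x = b) {s : σ}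
    (hs : M.step s a = s) {w : List α} (hw : s ∈ M.acceptSet w) :
    (∃ i, w = List.replicate i a) ∨
      ∃ i v, w = List.replicate i a ++ b :: v ∧ M.step s b ∈ M.acceptSet v := by
  induction w with
  | nil => exact .inl ⟨0, rfl⟩
  | cons x w ih =>
    rw [mem_acceptSet_cons] at hw
    rcases hab x with rfl | rfl
    · rw [hs] at hw
      rcases ih hw with ⟨i, rfl⟩ | ⟨i, v, rfl, hv⟩
      · exact .inl ⟨i + 1, rfl⟩
      · exact .inr ⟨i + 1, v, rfl, hv⟩
    · exact .inr ⟨0, w, rfl, hw⟩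

lemma moved_ncard_le [Finite σ] {a : α} {T : Finset σ} (hT : ∀ q ∈ T, M.step q a = q) :
    (M.moved a).ncard ≤ Nat.card σ - T.card := by
  have h : M.moved a ⊆ (T : Set σ)ᶜ := fun q hq hqT => hq (hT q hqT)
  refine (Set.ncard_le_ncard h (Set.toFinite _)).trans ?_
  rw [Set.ncard_compl, Set.ncard_coe_finset]

/-- A DFA accepting the reverse of `M.accepts`, whose states are the sets `M.acceptSet w`. -/
def reverseDFA (M : DFA α σ) : DFA α (Set.range M.acceptSet) where
  step Y a := ⟨{q | M.step q a ∈ Y.1}, by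
    obtain ⟨_, w, rfl⟩ := Y
    exact ⟨a :: w, rfl⟩⟩
  start := ⟨M.acceptSet [], [], rfl⟩
  accept := {Y | M.start ∈ Y.1}

lemma reverseDFA_eval (w : List α) : (M.reverseDFA.eval w).1 = M.acceptSet w.reverse := by
  induction w using List.reverseRecOn with
  | nil => rfl
  | append_singleton w a ih =>
    rw [eval_append_singleton, List.reverse_append]
    change {q | M.step q a ∈ (M.reverseDFA.eval w).1} = _
    rw [ih]
    rfl

lemma reverseDFA_accepts : M.reverseDFA.accepts = M.accepts.reverse := by
  ext w
  rw [mem_accepts, Language.mem_reverse, mem_accepts]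
  change M.start ∈ (M.reverseDFA.eval w).1 ↔ _
  rw [reverseDFA_eval]
  rfl

lemma stateComplexity_le [Finite σ] (M : DFA α σ) : stateComplexity M.accepts ≤ Nat.card σ :=
  Nat.sInf_le ⟨reindex (Finite.equivFin σ) M, accepts_reindex _ _⟩

lemma stateComplexity_reverse_le [Finite σ] (M : DFA α σ) :
    stateComplexity M.accepts.reverse ≤ (Set.range M.acceptSet).ncard := by
  rw [← reverseDFA_accepts]
  exact stateComplexity_le _

lemma MinimalDFA.stateComplexity_eq [Finite σ] (hM : M.MinimalDFA) :
    stateComplexity M.accepts = Nat.card σ := by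
  refine le_antisymm M.stateComplexity_le ?_
  obtain ⟨N, hN⟩ := Nat.sInf_mem
    (s := {n : ℕ | ∃ N : DFA α (Fin n), N.accepts = M.accepts})
    ⟨_, reindex (Finite.equivFin σ) M, accepts_reindex _ _⟩
  choose u hu using hM.1
  have hinj : Function.Injective fun q => N.eval (u q) := by
    intro p q hpq
    by_contra hne
    obtain ⟨w, hw⟩ := hM.2 p q hne
    apply hw
    have key : ∀ r, M.evalFrom r w ∈ M.accept ↔ N.evalFrom (N.eval (u r)) w ∈ N.accept := by
      intro r
      have h : u r ++ w ∈ N.accepts ↔ u r ++ w ∈ M.accepts := by rw [hN]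
      rw [mem_accepts, mem_accepts, eval, eval, evalFrom_of_append, evalFrom_of_append, hu] at h
      exact h.symm
    rw [key p, key q]
    exact iff_of_eq (congrArg (N.evalFrom · w ∈ N.accept) hpq)
  simpa [stateComplexity] using Nat.card_le_card_of_injective _ hinj

/-- If the reverse language is R-trivial, then the minimal DFA has at most one absorbing state. -/
lemma MinimalDFA.absorbing_unique (hM : M.MinimalDFA) (hR : IsRTrivial M.accepts.reverse)
    {p q : σ} (hp : ∀ x, M.step p x = p) (hq : ∀ x, M.step q x = q) : p = q := by
  by_contra hne
  obtain ⟨w, hw⟩ := hM.2 p q hne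
  rw [evalFrom_eq_self hp, evalFrom_eq_self hq] at hw
  obtain ⟨m, N, -, hN, hpo⟩ := hR
  obtain ⟨_, ⟨z, rfl⟩, hz⟩ := hpo.exists_maximal (T := Set.range N.eval) (Set.range_nonempty _)
  have key : ∀ r, (∀ x, M.step r x = r) → (N.eval z ∈ N.accept ↔ r ∈ M.accept) := by
    intro r hr
    obtain ⟨u, hu⟩ := hM.1 r
    have h : z ++ u.reverse ∈ N.accepts ↔ z ++ u.reverse ∈ M.accepts.reverse := by rw [hN]
    rw [Language.mem_reverse, mem_accepts, mem_accepts, List.reverse_append, List.reverse_reverse,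
      eval, eval, evalFrom_of_append, evalFrom_of_append, hu, evalFrom_eq_self hr] at h
    rwa [← eval, hz _ ⟨z ++ u.reverse, N.evalFrom_of_append _ _ _⟩] at h
  exact hw ((key p hp).symm.trans (key q hq))

lemma ncard_le_card_of_forall_exists {ι β : Type*} {S : Set β} (T : Finset ι) (g : ι → β)
    (h : ∀ y ∈ S, ∃ i ∈ T, g i = y) : S.ncard ≤ T.card := by
  have hsub : S ⊆ g '' (T : Set ι) := h
  have himage : (g '' (T : Set ι)).ncard ≤ (T : Set ι).ncard :=
    Set.ncard_image_le T.finite_toSet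
  rw [Set.ncard_coe_finset] at himage
  exact (Set.ncard_le_ncard hsub (T.finite_toSet.image g)).trans himage

section Counting

variable {a b : α} {d r s : σ}

lemma notMem_acceptSet (hd : ∀ x, M.step d x = d) (hdF : d ∉ M.accept) (w : List α) :
    d ∉ M.acceptSet w := by
  rwa [mem_acceptSet, evalFrom_eq_self hd]

lemma mem_acceptSet_replicate (hra : M.step r a = r) (hrF : r ∈ M.accept) (i : ℕ) :
    r ∈ M.acceptSet (List.replicate i a) := by
  rw [mem_acceptSet, evalFrom_replicate,
    Function.iterate_fixed (f := fun p => M.step p a) hra]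
  exact hrF

lemma eq_replicate_of_mem_acceptSet (hd : ∀ x, M.step d x = d) (hdF : d ∉ M.accept)
    (hab : ∀ x, x = a ∨ x = b) (hra : M.step r a = r) (hrb : M.step r b = d)
    {w : List α} (hw : r ∈ M.acceptSet w) : ∃ i, w = List.replicate i a := by
  rcases eq_replicate_or_of_mem_acceptSet hab hra hw with h | ⟨i, v, -, hv⟩
  · exact h
  · exact absurd (hrb ▸ hv) (notMem_acceptSet hd hdF v)

lemma eq_nil_of_mem_acceptSet (hd : ∀ x, M.step d x = d) (hdF : d ∉ M.accept)
    (hr : ∀ x, M.step r x = d) {w : List α} (hw : r ∈ M.acceptSet w) : w = [] := by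
  cases w with
  | nil => rfl
  | cons x v =>
    rw [mem_acceptSet_cons, hr] at hw
    exact absurd hw (notMem_acceptSet hd hdF v)

lemma moved_ncard_le_of_two [Finite σ] (h : r ≠ d) (hd : M.step d a = d) (hr : M.step r a = r) :
    (M.moved a).ncard ≤ Nat.card σ - 2 := by
  classical
  have := moved_ncard_le (M := M) (a := a) (T := {r, d}) (by simp [hd, hr])
  rwa [Finset.card_pair h] at this

lemma moved_ncard_le_of_three [Finite σ] (hrd : r ≠ d) (hsd : s ≠ d) (hsr : s ≠ r)
    (hd : M.step d a = d) (hr : M.step r a = r) (hs : M.step s a = s) :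
    (M.moved a).ncard ≤ Nat.card σ - 3 := by
  classical
  have := moved_ncard_le (M := M) (a := a) (T := {s, r, d}) (by simp [hd, hr, hs])
  rwa [Finset.card_eq_three.2 ⟨s, r, d, hsr, hsd, hrd, rfl⟩] at this

variable [Finite σ]

lemma PartiallyOrderedDFA.ncard_mem_le (hpo : M.PartiallyOrderedDFA)
    (hd : ∀ x, M.step d x = d) (hdF : d ∉ M.accept) (hab : ∀ x, x = a ∨ x = b) (hrd : r ≠ d)
    (hra : M.step r a = r) (hrb : M.step r b = d) :
    {Y ∈ Set.range M.acceptSet | r ∈ Y}.ncard ≤ Nat.card σ - 2 + 1 := by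
  rw [← Finset.card_range (Nat.card σ - 2 + 1)]
  apply ncard_le_card_of_forall_exists _ fun i => M.acceptSet (List.replicate i a)
  rintro _ ⟨⟨w, rfl⟩, hw⟩
  obtain ⟨i, rfl⟩ := eq_replicate_of_mem_acceptSet hd hdF hab hra hrb hw
  refine ⟨min i (Nat.card σ - 2), ?_, hpo.acceptSet_replicate_min'
    (moved_ncard_le_of_two hrd (hd a) hra) i⟩
  rw [Finset.mem_range]
  omega

/-- Both `s` and `r` are fixed by `a`, and `b` leads from `s` to `r` to the dead state. -/
lemma PartiallyOrderedDFA.ncard_le_of_same_loop (hpo : M.PartiallyOrderedDFA)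
    (hd : ∀ x, M.step d x = d) (hdF : d ∉ M.accept) (hab : ∀ x, x = a ∨ x = b)
    (hrd : r ≠ d) (hsd : s ≠ d) (hsr : s ≠ r) (hrF : r ∈ M.accept)
    (hra : M.step r a = r) (hrb : M.step r b = d) (hsa : M.step s a = s) (hsb : M.step s b = r)
    (hn : 4 ≤ Nat.card σ) :
    {Y ∈ Set.range M.acceptSet | r ∉ Y ∧ s ∈ Y}.ncard ≤ (Nat.card σ - 2) ^ 2 := by
  set n := Nat.card σ with hn'
  have hcard : (Finset.range (n - 2) ×ˢ Finset.range (n - 2)).card = (n - 2) ^ 2 := by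
    rw [Finset.card_product, Finset.card_range, sq]
  have hm : (M.moved a).ncard ≤ n - 3 := moved_ncard_le_of_three hrd hsd hsr (hd a) hra hsa
  rw [← hcard]
  apply ncard_le_card_of_forall_exists _
    fun p : ℕ × ℕ => M.acceptSet (List.replicate p.1 a ++ b :: List.replicate p.2 a)
  rintro _ ⟨⟨w, rfl⟩, hrw, hsw⟩
  rcases eq_replicate_or_of_mem_acceptSet hab hsa hsw with ⟨i, rfl⟩ | ⟨i, v, rfl, hv⟩
  · exact absurd (mem_acceptSet_replicate hra hrF i) hrw
  rw [hsb] at hv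
  obtain ⟨j, rfl⟩ := eq_replicate_of_mem_acceptSet hd hdF hab hra hrb hv
  refine ⟨(min i (n - 3), min j (n - 3)), ?_, ?_⟩
  · simp only [Finset.mem_product, Finset.mem_range]
    omega
  · rw [hpo.acceptSet_replicate_min hm]
    exact acceptSet_append_congr (acceptSet_cons_congr (hpo.acceptSet_replicate_min' hm j) b) _

/-- `s` is fixed by `b` and `r` is fixed by `a`, while `a` leads from `s` to `r` and `b` leads
from `r` to the dead state. -/
lemma PartiallyOrderedDFA.ncard_le_of_distinct_loops (hpo : M.PartiallyOrderedDFA)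
    (hd : ∀ x, M.step d x = d) (hdF : d ∉ M.accept) (hab : ∀ x, x = a ∨ x = b)
    (hrd : r ≠ d) (hsd : s ≠ d) (hrF : r ∈ M.accept)
    (hra : M.step r a = r) (hrb : M.step r b = d) (hsb : M.step s b = s) (hsa : M.step s a = r)
    (hn : 4 ≤ Nat.card σ) :
    {Y ∈ Set.range M.acceptSet | r ∉ Y ∧ s ∈ Y}.ncard ≤ (Nat.card σ - 2) ^ 2 := by
  set n := Nat.card σ with hn'
  have hma : (M.moved a).ncard ≤ n - 2 := moved_ncard_le_of_two hrd (hd a) hra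
  have hmb : (M.moved b).ncard ≤ n - 2 := moved_ncard_le_of_two hsd (hd b) hsb
  set Z : Set σ := {q | (fun p => M.step p b)^[n - 2] q = s} with hZ
  set T := Finset.Icc 1 (n - 3) ×ˢ Finset.range (n - 1) with hT
  have hcard : T.card + 1 = (n - 2) ^ 2 := by
    rw [hT, Finset.card_product, Finset.card_range, Nat.card_Icc]
    obtain ⟨k, hk⟩ := Nat.exists_eq_add_of_le hn
    rw [hk, show 4 + k - 3 + 1 - 1 = k + 1 by omega, show 4 + k - 1 = k + 3 by omega,
      show 4 + k - 2 = k + 2 by omega]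
    ring
  -- if `b` fixes only `s` and `d`, then a full power of `b` forces the acceptance set `Z`
  have hfull : ∀ v, s ∈ M.acceptSet v → ¬ (M.moved b).ncard ≤ n - 3 →
      M.acceptSet (List.replicate (n - 2) b ++ v) = Z := by
    intro v hv hlarge
    have hfix : ∀ q, M.step q b = q → q ≠ s → q = d := by
      intro q hq hqs
      by_contra hqd
      exact hlarge (moved_ncard_le_of_three hsd hqd hqs (hd b) hsb hq)
    ext q
    rw [mem_acceptSet_append, evalFrom_replicate]
    constructor
    · intro h
      by_contra hne
      rw [hfix _ (hpo.step_iterate hmb q) hne] at h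
      exact notMem_acceptSet hd hdF v h
    · intro h
      rw [h]
      exact hv
  have hsub : {Y ∈ Set.range M.acceptSet | r ∉ Y ∧ s ∈ Y} \ {Z} ⊆
      {Y | ∃ p ∈ T, M.acceptSet (List.replicate p.1 b ++ List.replicate p.2 a) = Y} := by
    rintro _ ⟨⟨⟨w, rfl⟩, hrw, hsw⟩, hwZ⟩
    obtain ⟨i, j, rfl⟩ : ∃ i j, w = List.replicate i b ++ List.replicate j a := by
      rcases eq_replicate_or_of_mem_acceptSet (fun x => (hab x).symm) hsb hsw with
        ⟨i, rfl⟩ | ⟨i, v, rfl, hv⟩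
      · exact ⟨i, 0, by simp⟩
      · rw [hsa] at hv
        obtain ⟨j, rfl⟩ := eq_replicate_of_mem_acceptSet hd hdF hab hra hrb hv
        exact ⟨i, j + 1, rfl⟩
    have hi : i ≠ 0 := by
      rintro rfl
      exact hrw (mem_acceptSet_replicate hra hrF j)
    have hsj : s ∈ M.acceptSet (List.replicate j a) := by
      rwa [mem_acceptSet_append, evalFrom_replicate,
        Function.iterate_fixed (f := fun p => M.step p b) hsb] at hsw
    have hj := acceptSet_append_congr (hpo.acceptSet_replicate_min' hma j)
    by_cases hcase : (M.moved b).ncard ≤ n - 3 ∨ i ≤ n - 3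
    · refine ⟨(min i (n - 3), min j (n - 2)), ?_, ?_⟩
      · simp only [hT, Finset.mem_product, Finset.mem_range, Finset.mem_Icc]
        omega
      · rw [hj]
        rcases hcase with h | h
        · exact hpo.acceptSet_replicate_min h i _
        · rw [min_eq_left h]
    · push Not at hcase
      apply absurd _ hwZ
      rw [Set.mem_singleton_iff, ← hpo.acceptSet_replicate_min hmb,
        min_eq_right (by omega : n - 2 ≤ i)]
      exact hfull _ hsj (by omega)
  have hle := ncard_le_card_of_forall_exists T
    (fun p => M.acceptSet (List.replicate p.1 b ++ List.replicate p.2 a)) hsub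
  have := Set.ncard_le_ncard_sdiff_add_ncard {Y ∈ Set.range M.acceptSet | r ∉ Y ∧ s ∈ Y} {Z}
  rw [Set.ncard_singleton] at this
  omega

/-- The state `r` has a loop, and every transition from `s` leads to `s`, `r` or `d`. -/
lemma PartiallyOrderedDFA.ncard_le_of_loop (hpo : M.PartiallyOrderedDFA)
    (hd : ∀ x, M.step d x = d) (hdF : d ∉ M.accept) (hab : ∀ x, x = a ∨ x = b)
    (hrd : r ≠ d) (hsd : s ≠ d) (hsr : s ≠ r) (hrF : r ∈ M.accept)
    (hra : M.step r a = r) (hrb : M.step r b = d)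
    (hs : ∀ x, M.step s x = s ∨ M.step s x = r ∨ M.step s x = d) (hs' : ∃ x, M.step s x ≠ s)
    (hn : 4 ≤ Nat.card σ) :
    {Y ∈ Set.range M.acceptSet | r ∉ Y ∧ s ∈ Y}.ncard ≤
      max (2 * Nat.card σ - 3) ((Nat.card σ - 2) ^ 2) := by
  set n := Nat.card σ with hn'
  have hlin : n - 2 + 1 ≤ max (2 * n - 3) ((n - 2) ^ 2) := le_max_of_le_left (by omega)
  by_cases hsa : M.step s a = s
  · rcases hs b with hsb | hsb | hsb
    · obtain ⟨x, hx⟩ := hs'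
      rcases hab x with rfl | rfl <;> contradiction
    · exact le_max_of_le_right
        (hpo.ncard_le_of_same_loop hd hdF hab hrd hsd hsr hrF hra hrb hsa hsb hn)
    · rw [Set.ncard_eq_zero (Set.toFinite _) |>.2]
      · exact Nat.zero_le _
      · rw [Set.eq_empty_iff_forall_notMem]
        rintro _ ⟨⟨w, rfl⟩, hrw, hsw⟩
        obtain ⟨i, rfl⟩ := eq_replicate_of_mem_acceptSet hd hdF hab hsa hsb hsw
        exact hrw (mem_acceptSet_replicate hra hrF i)
  by_cases hsb : M.step s b = s
  · rcases hs a with h | hsa | hsa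
    · contradiction
    · exact le_max_of_le_right
        (hpo.ncard_le_of_distinct_loops hd hdF hab hrd hsd hrF hra hrb hsb hsa hn)
    · refine le_trans (Set.ncard_le_ncard ?_ (Set.toFinite _)) ((hpo.ncard_mem_le hd hdF
        (fun x => (hab x).symm) hsd hsb hsa).trans hlin)
      exact fun Y hY => ⟨hY.1, hY.2.2⟩
  · refine le_trans ?_ hlin
    rw [← Finset.card_range (n - 2 + 1)]
    apply ncard_le_card_of_forall_exists _ fun i => M.acceptSet (b :: List.replicate i a)
    rintro _ ⟨⟨w, rfl⟩, hrw, hsw⟩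
    have hstep : ∀ x v, M.step s x ≠ s → s ∈ M.acceptSet (x :: v) →
        ∃ i, v = List.replicate i a := by
      intro x v hx hv
      rw [mem_acceptSet_cons] at hv
      rcases hs x with h | h | h
      · contradiction
      · exact eq_replicate_of_mem_acceptSet hd hdF hab hra hrb (h ▸ hv)
      · exact absurd (h ▸ hv) (notMem_acceptSet hd hdF v)
    rcases w with _ | ⟨x, v⟩
    · exact absurd hrF hrw
    rcases hab x with rfl | rfl
    · obtain ⟨i, rfl⟩ := hstep _ v hsa hsw
      exact absurd (mem_acceptSet_replicate hra hrF (i + 1)) hrw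
    · obtain ⟨i, rfl⟩ := hstep _ v hsb hsw
      refine ⟨min i (n - 2), ?_, acceptSet_cons_congr (hpo.acceptSet_replicate_min'
        (moved_ncard_le_of_two hrd (hd a) hra) i) _⟩
      rw [Finset.mem_range]
      omega

/-- Every transition from `r` leads to the dead state, and `s` is fixed by `a`. -/
lemma PartiallyOrderedDFA.ncard_le_of_no_loop_aux (hpo : M.PartiallyOrderedDFA)
    (hd : ∀ x, M.step d x = d) (hdF : d ∉ M.accept) (hab : ∀ x, x = a ∨ x = b)
    (hsd : s ≠ d) (hrF : r ∈ M.accept) (hr : ∀ x, M.step r x = d)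
    (hsa : M.step s a = s) (hsb : M.step s b = r ∨ M.step s b = d) (hn : 4 ≤ Nat.card σ) :
    {Y ∈ Set.range M.acceptSet | r ∉ Y ∧ s ∈ Y}.ncard ≤ 2 * Nat.card σ - 3 := by
  set n := Nat.card σ with hn'
  have hm : (M.moved a).ncard ≤ n - 2 := moved_ncard_le_of_two hsd (hd a) hsa
  have hcard : ((Finset.Icc 1 (n - 2)).disjSum (Finset.range (n - 1))).card = 2 * n - 3 := by
    rw [Finset.card_disjSum, Finset.card_range, Nat.card_Icc]
    omega
  rw [← hcard]
  apply ncard_le_card_of_forall_exists _ (Sum.elim (fun i => M.acceptSet (List.replicate i a))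
    fun i => M.acceptSet (List.replicate i a ++ [b]))
  rintro _ ⟨⟨w, rfl⟩, hrw, hsw⟩
  rcases eq_replicate_or_of_mem_acceptSet hab hsa hsw with ⟨i, rfl⟩ | ⟨i, v, rfl, hv⟩
  · refine ⟨.inl (min i (n - 2)), ?_, hpo.acceptSet_replicate_min' hm i⟩
    have hi : i ≠ 0 := by
      rintro rfl
      exact hrw hrF
    rw [Finset.inl_mem_disjSum, Finset.mem_Icc]
    omega
  · rcases hsb with hsb | hsb
    · rw [hsb] at hv
      obtain rfl := eq_nil_of_mem_acceptSet hd hdF hr hv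
      refine ⟨.inr (min i (n - 2)), ?_, hpo.acceptSet_replicate_min hm i _⟩
      rw [Finset.inr_mem_disjSum, Finset.mem_range]
      omega
    · exact absurd (hsb ▸ hv) (notMem_acceptSet hd hdF v)

/-- Every transition from `r` leads to `d`, and every transition from `s` to `s`, `r` or `d`. -/
lemma PartiallyOrderedDFA.ncard_le_of_no_loop (hpo : M.PartiallyOrderedDFA)
    (hd : ∀ x, M.step d x = d) (hdF : d ∉ M.accept) (hab : ∀ x, x = a ∨ x = b)
    (hsd : s ≠ d) (hrF : r ∈ M.accept) (hr : ∀ x, M.step r x = d)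
    (hs : ∀ x, M.step s x = s ∨ M.step s x = r ∨ M.step s x = d) (hs' : ∃ x, M.step s x ≠ s)
    (hn : 4 ≤ Nat.card σ) :
    {Y ∈ Set.range M.acceptSet | r ∉ Y ∧ s ∈ Y}.ncard ≤ 2 * Nat.card σ - 3 := by
  by_cases hsa : M.step s a = s
  · refine hpo.ncard_le_of_no_loop_aux hd hdF hab hsd hrF hr hsa ((hs b).resolve_left ?_) hn
    intro hsb
    obtain ⟨x, hx⟩ := hs'
    rcases hab x with rfl | rfl <;> contradiction
  by_cases hsb : M.step s b = s
  · exact hpo.ncard_le_of_no_loop_aux hd hdF (fun x => (hab x).symm) hsd hrF hr hsb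
      ((hs a).resolve_left hsa) hn
  · have hcard : (Finset.univ : Finset Bool).card ≤ 2 * Nat.card σ - 3 := by
      rw [Finset.card_univ, Fintype.card_bool]
      omega
    refine (ncard_le_card_of_forall_exists _
      (fun c : Bool => M.acceptSet [if c then a else b]) ?_).trans hcard
    rintro _ ⟨⟨w, rfl⟩, hrw, hsw⟩
    rcases w with _ | ⟨x, v⟩
    · exact absurd hrF hrw
    obtain rfl : v = [] := by
      rw [mem_acceptSet_cons] at hsw
      rcases hs x with h | h | h
      · rcases hab x with rfl | rfl <;> contradiction
      · exact eq_nil_of_mem_acceptSet hd hdF hr (h ▸ hsw)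
      · exact absurd (h ▸ hsw) (notMem_acceptSet hd hdF v)
    rcases hab x with rfl | rfl
    · exact ⟨true, Finset.mem_univ _, rfl⟩
    · exact ⟨false, Finset.mem_univ _, rfl⟩

lemma ncard_subsets_compl_le (T : Finset σ) :
    {Y : Set σ | ∀ q ∈ T, q ∉ Y}.ncard ≤ 2 ^ (Nat.card σ - T.card) := by
  have h : {Y : Set σ | ∀ q ∈ T, q ∉ Y} = 𝒫 (T : Set σ)ᶜ := by
    ext Y
    exact ⟨fun hY q hq hqT => hY q hqT hq, fun hY q hqT hq => hY hq hqT⟩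
  rw [h, Set.ncard_powerset _ (Set.toFinite _), Set.ncard_compl, Set.ncard_coe_finset]

lemma ncard_le_two_pow {C : Set (Set σ)} (hrd : r ≠ d) (hsd : s ≠ d) (hsr : s ≠ r)
    (hC : ∀ Y ∈ C, d ∉ Y ∧ r ∉ Y) (hC' : (∀ Y ∈ C, s ∈ Y) ∨ ∀ Y ∈ C, s ∉ Y) :
    C.ncard ≤ 2 ^ (Nat.card σ - 3) := by
  classical
  have hT : ({s, r, d} : Finset σ).card = 3 :=
    Finset.card_eq_three.2 ⟨s, r, d, hsr, hsd, hrd, rfl⟩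
  have hle := ncard_subsets_compl_le ({s, r, d} : Finset σ)
  rw [hT] at hle
  refine le_trans ?_ hle
  rcases hC' with hs | hs
  · refine Set.ncard_le_ncard_of_injOn (fun Y => Y \ {s}) ?_ ?_ (Set.toFinite _)
    · intro Y hY
      simp [hC Y hY]
    · intro Y hY Y' hY' h
      rw [← Set.insert_sdiff_self_of_mem (hs Y hY), ← Set.insert_sdiff_self_of_mem (hs Y' hY')]
      exact congrArg (insert s) h
  · refine Set.ncard_le_ncard ?_ (Set.toFinite _)
    intro Y hY
    simp [hC Y hY, hs Y hY]

end Counting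

/-- The main estimate, for a partially ordered binary DFA with a unique absorbing state `d` that is
rejecting, and every other state of which accepts some word. -/
theorem PartiallyOrderedDFA.ncard_range_acceptSet_le [Finite σ] (hpo : M.PartiallyOrderedDFA)
    {a b : α} (hab : ∀ x, x = a ∨ x = b) {d : σ} (hd : ∀ x, M.step d x = d) (hdF : d ∉ M.accept)
    (hd_unique : ∀ q, (∀ x, M.step q x = q) → q = d)
    (hlive : ∀ q, q ≠ d → ∃ w, M.evalFrom q w ∈ M.accept) (hn : 4 ≤ Nat.card σ) :
    (Set.range M.acceptSet).ncard ≤ 2 ^ (Nat.card σ - 3) +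
      min (max (2 * Nat.card σ - 3) ((Nat.card σ - 2) ^ 2)) (2 ^ (Nat.card σ - 3)) +
      (Nat.card σ - 1) := by
  classical
  set n := Nat.card σ with hn'
  have hmaximal : ∀ T : Finset σ, T.card < n → ∃ m ∉ T, ∀ w, M.evalFrom m w = m ∨
      M.evalFrom m w ∈ T := by
    intro T hT
    have hne : ((T : Set σ)ᶜ).Nonempty := by
      rw [Set.nonempty_compl]
      intro h
      have := congrArg Set.ncard h
      rw [Set.ncard_coe_finset, Set.ncard_univ] at this
      omega
    obtain ⟨m, hm, hm'⟩ := hpo.exists_maximal hne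
    refine ⟨m, hm, fun w => ?_⟩
    by_cases h : M.evalFrom m w ∈ T
    · exact .inr h
    · exact .inl (hm' w h)
  have hleave : ∀ q, q ≠ d → ∃ x, M.step q x ≠ q := by
    intro q hq
    by_contra! h
    exact hq (hd_unique q h)
  obtain ⟨r, hrT, hr⟩ := hmaximal {d} (by rw [Finset.card_singleton]; omega)
  have hrd : r ≠ d := by simpa using hrT
  simp only [Finset.mem_singleton] at hr
  obtain ⟨s, hsT, hs⟩ := hmaximal {r, d} (by rw [Finset.card_pair hrd]; omega)
  simp only [Finset.mem_insert, Finset.mem_singleton, not_or] at hsT hs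
  obtain ⟨hsr, hsd⟩ := hsT
  have hs1 : ∀ x, M.step s x = s ∨ M.step s x = r ∨ M.step s x = d := fun x => hs [x]
  have hr1 : ∀ x, M.step r x = r ∨ M.step r x = d := fun x => hr [x]
  have hrF : r ∈ M.accept := by
    obtain ⟨w, hw⟩ := hlive r hrd
    rcases hr w with h | h <;> rw [h] at hw
    · exact hw
    · exact absurd hw hdF
  have hbounds : {Y ∈ Set.range M.acceptSet | r ∈ Y}.ncard ≤ n - 1 ∧
      {Y ∈ Set.range M.acceptSet | r ∉ Y ∧ s ∈ Y}.ncard ≤ max (2 * n - 3) ((n - 2) ^ 2) := by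
    by_cases hloop : ∀ x, M.step r x = d
    · refine ⟨?_, le_max_of_le_left (hpo.ncard_le_of_no_loop hd hdF hab hsd hrF hloop hs1
        (hleave s hsd) hn)⟩
      refine (ncard_le_card_of_forall_exists (Finset.range 1) (fun _ => M.acceptSet []) ?_).trans
        (by rw [Finset.card_range]; omega)
      rintro _ ⟨⟨w, rfl⟩, hw⟩
      rw [eq_nil_of_mem_acceptSet hd hdF hloop hw]
      exact ⟨0, by simp, rfl⟩
    · push Not at hloop
      obtain ⟨x, hx⟩ := hloop
      obtain ⟨y, hxy⟩ : ∃ y, ∀ z, z = x ∨ z = y := by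
        rcases hab x with rfl | rfl
        · exact ⟨b, hab⟩
        · exact ⟨a, fun z => (hab z).symm⟩
      have hrx : M.step r x = r := (hr1 x).resolve_right hx
      have hry : M.step r y = d := by
        refine (hr1 y).resolve_left fun h => ?_
        obtain ⟨z, hz⟩ := hleave r hrd
        rcases hxy z with rfl | rfl <;> contradiction
      exact ⟨(hpo.ncard_mem_le hd hdF hxy hrd hrx hry).trans (by omega),
        hpo.ncard_le_of_loop hd hdF hxy hrd hsd hsr hrF hrx hry hs1 (hleave s hsd) hn⟩
  have hdead : ∀ Y ∈ Set.range M.acceptSet, d ∉ Y := by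
    rintro _ ⟨w, rfl⟩
    exact notMem_acceptSet hd hdF w
  have hmem : {Y ∈ Set.range M.acceptSet | r ∉ Y ∧ s ∈ Y}.ncard ≤ 2 ^ (n - 3) :=
    ncard_le_two_pow hrd hsd hsr (fun Y hY => ⟨hdead Y hY.1, hY.2.1⟩) (.inl fun Y hY => hY.2.2)
  have hnotMem : {Y ∈ Set.range M.acceptSet | r ∉ Y ∧ s ∉ Y}.ncard ≤ 2 ^ (n - 3) :=
    ncard_le_two_pow hrd hsd hsr (fun Y hY => ⟨hdead Y hY.1, hY.2.1⟩) (.inr fun Y hY => hY.2.2)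
  have hcover : Set.range M.acceptSet ⊆ {Y ∈ Set.range M.acceptSet | r ∉ Y ∧ s ∉ Y} ∪
      {Y ∈ Set.range M.acceptSet | r ∉ Y ∧ s ∈ Y} ∪ {Y ∈ Set.range M.acceptSet | r ∈ Y} := by
    intro Y hY
    by_cases h : r ∈ Y
    · exact .inr ⟨hY, h⟩
    · by_cases h' : s ∈ Y
      · exact .inl (.inr ⟨hY, h, h'⟩)
      · exact .inl (.inl ⟨hY, h, h'⟩)
  calc (Set.range M.acceptSet).ncard
      ≤ _ := Set.ncard_le_ncard hcover (Set.toFinite _)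
    _ ≤ _ := Set.ncard_union_le _ _
    _ ≤ _ := Nat.add_le_add_right (Set.ncard_union_le _ _) _
    _ ≤ _ := Nat.add_le_add (Nat.add_le_add hnotMem (le_min hbounds.2 hmem)) hbounds.1

lemma ncard_range_acceptSet_compl :
    (Set.range Mᶜ.acceptSet).ncard = (Set.range M.acceptSet).ncard := by
  have h : Mᶜ.acceptSet = compl ∘ M.acceptSet := rfl
  rw [h, Set.range_comp, Set.ncard_image_of_injective _ compl_injective]

end DFA

theorem statement14 (n : ℕ) (hn : 4 ≤ n) (L : Language (Fin 2))
    (hJ : IsJTrivial L) (hsc : stateComplexity L = n) :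
    stateComplexity L.reverse ≤
      2 ^ (n - 3) + min (max (2 * n - 3) ((n - 2) ^ 2)) (2 ^ (n - 3)) + (n - 1) := by
  obtain ⟨⟨m, M, hM, rfl, hpo⟩, hR⟩ := hJ
  have hcard : Nat.card (Fin m) = n := hM.stateComplexity_eq.symm.trans hsc
  refine M.stateComplexity_reverse_le.trans ?_
  have hab : ∀ x : Fin 2, x = 0 ∨ x = 1 := by decide
  obtain ⟨d, -, hd⟩ := hpo.exists_maximal (T := Set.univ) ⟨M.start, trivial⟩
  have hstep : ∀ x, M.step d x = d := fun x => hd [x] trivial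
  have hunique : ∀ q, (∀ x, M.step q x = q) → q = d :=
    fun q hq => hM.absorbing_unique hR hq hstep
  rw [← hcard] at hn ⊢
  by_cases hdF : d ∈ M.accept
  · rw [← DFA.ncard_range_acceptSet_compl]
    refine DFA.PartiallyOrderedDFA.ncard_range_acceptSet_le (M := Mᶜ) hpo hab hstep
      (fun h => h hdF) hunique (fun q hq => ?_) hn
    obtain ⟨w, hw⟩ := hM.2 q d hq
    rw [DFA.evalFrom_eq_self hstep, iff_true_right hdF] at hw
    exact ⟨w, hw⟩
  · refine hpo.ncard_range_acceptSet_le hab hstep hdF hunique (fun q hq => ?_) hn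
    obtain ⟨w, hw⟩ := hM.2 q d hq
    rw [DFA.evalFrom_eq_self hstep, iff_false_right hdF, not_not] at hw
    exact ⟨w, hw⟩
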